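/- Let φ ∈ C_c^∞(ℝ^n) with supp φ ⊆ B(0,1), 0 ≤ φ ≤ 1, and ∫ φ = 1; set φ_t(x) = t^{−n} φ(x/t) and A_t f = φ_t * f. Then for every f ∈ L²_loc(ℝ^n), every t > 0 and every ball B ⊂ ℝ^n, ( |B|⁻¹ ∫_B |A_t f(x) − (A_t f)_B|² dx )^{1/2} ≤ sup_{|z| ≤ t} ( |τ_z B|⁻¹ ∫_{τ_z B} |f(x) − f_{τ_z B}|² dx )^{1/2}, where τ_z B = { x − z : x ∈ B } and g_E = |E|⁻¹ ∫_E g. -/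

import Mathlib

open MeasureTheory Metric

/-- The square of a mean is at most the mean of the square. -/
theorem sq_integral_le_integral_sq {Z : Type*} [MeasurableSpace Z] {P : Measure Z}
    [IsProbabilityMeasure P] {g : Z → ℝ} (hg : MemLp g 2 P) :
    (∫ z, g z ∂P) ^ 2 ≤ ∫ z, g z ^ 2 ∂P := by
  have h := ProbabilityTheory.variance_nonneg g P
  rw [ProbabilityTheory.variance_eq_sub hg] at h
  simpa using h

/-- Almost every section of a square-integrable function is square-integrable. -/
theorem MeasureTheory.MemLp.two_prod_right_ae {X Z : Type*} [MeasurableSpace X]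
    [MeasurableSpace Z] {Q : Measure X} {P : Measure Z} [SFinite Q] [SFinite P]
    {F : X × Z → ℝ} (hF : MemLp F 2 (Q.prod P)) :
    ∀ᵐ x ∂Q, MemLp (fun z => F (x, z)) 2 P := by
  filter_upwards [hF.aestronglyMeasurable.prodMk_left, hF.integrable_sq.prod_right_ae]
    with x hx hx2
  exact (memLp_two_iff_integrable_sq hx).2 hx2

/-- Integrating out one variable maps `L²` to `L²`. -/
theorem MeasureTheory.MemLp.two_integral_prod_left {X Z : Type*} [MeasurableSpace X]
    [MeasurableSpace Z] {Q : Measure X} {P : Measure Z} [IsProbabilityMeasure Q]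
    [IsProbabilityMeasure P] {F : X × Z → ℝ} (hF : MemLp F 2 (Q.prod P)) :
    MemLp (fun x => ∫ z, F (x, z) ∂P) 2 Q := by
  have hm : AEStronglyMeasurable (fun x => ∫ z, F (x, z) ∂P) Q :=
    hF.aestronglyMeasurable.integral_prod_right'
  refine (memLp_two_iff_integrable_sq hm).2 ?_
  refine hF.integrable_sq.integral_prod_left.mono' (hm.pow 2) ?_
  filter_upwards [hF.two_prod_right_ae] with x hx
  rw [Real.norm_of_nonneg (sq_nonneg _)]
  exact sq_integral_le_integral_sq hx

/-- If almost every section `F (·, z)` has variance at most `K`, so does the average over `z`. -/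
theorem integral_sq_sub_integral_average_le {X Z : Type*} [MeasurableSpace X]
    [MeasurableSpace Z] {Q : Measure X} {P : Measure Z} [IsProbabilityMeasure Q]
    [IsProbabilityMeasure P] {F : X × Z → ℝ} (hF : MemLp F 2 (Q.prod P)) {K : ℝ}
    (hK : ∀ᵐ z ∂P, ∫ x, (F (x, z) - ∫ y, F (y, z) ∂Q) ^ 2 ∂Q ≤ K) :
    ∫ x, ((∫ z, F (x, z) ∂P) - ∫ y, ∫ z, F (y, z) ∂P ∂Q) ^ 2 ∂Q ≤ K := by
  have hm : MemLp (fun z => ∫ y, F (y, z) ∂Q) 2 P :=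
    MemLp.two_integral_prod_left (F := F ∘ Prod.swap)
      (hF.comp_measurePreserving Measure.measurePreserving_swap)
  have hG : MemLp (fun p : X × Z => F p - ∫ y, F (y, p.2) ∂Q) 2 (Q.prod P) :=
    hF.sub (hm.comp_snd Q)
  have hG2 := hG.integrable_sq
  have hswap : ∫ y, ∫ z, F (y, z) ∂P ∂Q = ∫ z, ∫ y, F (y, z) ∂Q ∂P :=
    integral_integral_swap (f := fun y z => F (y, z)) (hF.integrable one_le_two)
  calc ∫ x, ((∫ z, F (x, z) ∂P) - ∫ y, ∫ z, F (y, z) ∂P ∂Q) ^ 2 ∂Q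
      ≤ ∫ x, ∫ z, (F (x, z) - ∫ y, F (y, z) ∂Q) ^ 2 ∂P ∂Q := by
        refine integral_mono_of_nonneg (.of_forall fun x => sq_nonneg _)
          hG2.integral_prod_left ?_
        filter_upwards [hF.two_prod_right_ae, hG.two_prod_right_ae] with x hx hGx
        rw [hswap, ← integral_sub (hx.integrable one_le_two) (hm.integrable one_le_two)]
        exact sq_integral_le_integral_sq hGx
    _ = ∫ z, ∫ x, (F (x, z) - ∫ y, F (y, z) ∂Q) ^ 2 ∂Q ∂P :=
        integral_integral_swap (f := fun x z => (F (x, z) - ∫ y, F (y, z) ∂Q) ^ 2) hG2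
    _ ≤ ∫ _, K ∂P := integral_mono_ae hG2.integral_prod_right (integrable_const K) hK
    _ = K := by simp

/-- Integrating a translate of `f` over a ball amounts to integrating `f` over the
translated ball. -/
theorem setIntegral_ball_comp_sub_right {E : Type*} [NormedAddCommGroup E]
    [MeasurableSpace E] [BorelSpace E] {μ : Measure E} [μ.IsAddRightInvariant]
    (g : E → ℝ) (c z : E) (r : ℝ) :
    ∫ x in ball c r, g (x - z) ∂μ = ∫ x in ball (c - z) r, g x ∂μ := by
  have hpre : (fun x => x - z) ⁻¹' ball (c - z) r = ball c r := by
    ext x; simp [mem_ball, dist_eq_norm]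
  rw [← hpre]
  exact (measurePreserving_sub_right μ z).setIntegral_preimage_emb
    (measurableEmbedding_subRight z) g _

theorem stmt4 (n : ℕ) (φ : EuclideanSpace ℝ (Fin n) → ℝ)
    (hφ_smooth : ContDiff ℝ (⊤ : ℕ∞) φ) (hφ_supp : tsupport φ ⊆ closedBall 0 1)
    (hφ_nonneg : ∀ x, 0 ≤ φ x) (hφ_le_one : ∀ x, φ x ≤ 1)
    (hφ_int : ∫ x, φ x = 1)
    (f : EuclideanSpace ℝ (Fin n) → ℝ)
    (hf_loc : LocallyIntegrable f volume)
    (hf_loc2 : ∀ (c : EuclideanSpace ℝ (Fin n)) (r : ℝ),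
      IntegrableOn (fun y => f y ^ 2) (ball c r) volume)
    (t : ℝ) (ht : 0 < t)
    (Atf : EuclideanSpace ℝ (Fin n) → ℝ)
    (hAtf : ∀ x, Atf x = ∫ y, (t ^ n)⁻¹ * φ (t⁻¹ • (x - y)) * f y)
    (c : EuclideanSpace ℝ (Fin n)) (r : ℝ) (hr : 0 < r)
    (M : ℝ)
    (hM : ∀ z : EuclideanSpace ℝ (Fin n), ‖z‖ ≤ t →
      Real.sqrt ((volume (ball (c - z) r)).toReal⁻¹ *
        ∫ x in ball (c - z) r,
          (f x - (volume (ball (c - z) r)).toReal⁻¹ *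
            ∫ y in ball (c - z) r, f y) ^ 2) ≤ M) :
    Real.sqrt ((volume (ball c r)).toReal⁻¹ *
      ∫ x in ball c r,
        (Atf x - (volume (ball c r)).toReal⁻¹ * ∫ y in ball c r, Atf y) ^ 2)
      ≤ M := by
  have hψ_meas : Continuous fun z : EuclideanSpace ℝ (Fin n) => (t ^ n)⁻¹ * φ (t⁻¹ • z) :=
    continuous_const.mul (hφ_smooth.continuous.comp (continuous_const_smul _))
  set ψ : EuclideanSpace ℝ (Fin n) → ℝ := fun z => (t ^ n)⁻¹ * φ (t⁻¹ • z) with hψ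
  have hψ_nonneg : ∀ z, 0 ≤ ψ z := fun z => mul_nonneg (by positivity) (hφ_nonneg _)
  have hψ_supp : ∀ z, ψ z ≠ 0 → ‖z‖ ≤ t := by
    intro z hz
    have h1 : t⁻¹ • z ∈ closedBall (0 : EuclideanSpace ℝ (Fin n)) 1 :=
      hφ_supp (subset_tsupport _ (right_ne_zero_of_mul hz))
    rw [mem_closedBall_zero_iff, norm_smul, norm_inv, Real.norm_of_nonneg ht.le,
      inv_mul_le_iff₀ ht, mul_one] at h1
    exact h1
  have hψ_int : ∫ z, ψ z = 1 := by
    rw [hψ, integral_const_mul, Measure.integral_comp_smul, hφ_int, finrank_euclideanSpace_fin,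
      smul_eq_mul, mul_one, inv_pow, inv_inv, abs_of_pos (by positivity),
      inv_mul_cancel₀ (by positivity)]
  have hψ_integrable : Integrable ψ := by
    by_contra h
    simp [integral_undef h] at hψ_int
  set P : Measure (EuclideanSpace ℝ (Fin n)) :=
    volume.withDensity fun z => ENNReal.ofReal (ψ z) with hP
  have hP_prob : IsProbabilityMeasure P := by
    refine ⟨?_⟩
    rw [hP, withDensity_apply _ .univ, Measure.restrict_univ,
      ← ofReal_integral_eq_lintegral_ofReal hψ_integrable (.of_forall hψ_nonneg), hψ_int,
      ENNReal.ofReal_one]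
  have hP_int : ∀ g : EuclideanSpace ℝ (Fin n) → ℝ, ∫ z, g z ∂P = ∫ z, ψ z * g z := by
    intro g
    rw [hP, integral_withDensity_eq_integral_toReal_smul
      hψ_meas.measurable.ennreal_ofReal (.of_forall fun _ => ENNReal.ofReal_lt_top)]
    simp only [ENNReal.toReal_ofReal (hψ_nonneg _), smul_eq_mul]
  have hP_norm : ∀ᵐ z ∂P, ‖z‖ ≤ t := by
    rw [hP, ae_withDensity_iff hψ_meas.measurable.ennreal_ofReal]
    refine .of_forall fun z hz => hψ_supp z fun h => hz (by simp [h])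
  have hvol : ∀ z : EuclideanSpace ℝ (Fin n), volume (ball (c - z) r) = volume (ball c r) :=
    fun z => by rw [Measure.addHaar_ball_center, Measure.addHaar_ball_center volume c]
  have hB0 : volume (ball c r) ≠ 0 := (measure_ball_pos _ c hr).ne'
  have hBtop : volume (ball c r) ≠ ⊤ := measure_ball_lt_top.ne
  set Q : Measure (EuclideanSpace ℝ (Fin n)) :=
    (volume (ball c r))⁻¹ • volume.restrict (ball c r) with hQ
  have hQ_prob : IsProbabilityMeasure Q := by
    refine ⟨?_⟩
    simp [hQ, ENNReal.inv_mul_cancel hB0 hBtop]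
  have hQ_int : ∀ g : EuclideanSpace ℝ (Fin n) → ℝ,
      ∫ x, g x ∂Q = (volume (ball c r)).toReal⁻¹ * ∫ x in ball c r, g x := by
    intro g
    rw [hQ, integral_smul_measure, ENNReal.toReal_inv, smul_eq_mul]
  have hQ_translate : ∀ (g : EuclideanSpace ℝ (Fin n) → ℝ) (z : EuclideanSpace ℝ (Fin n)),
      ∫ x, g (x - z) ∂Q = (volume (ball c r)).toReal⁻¹ * ∫ x in ball (c - z) r, g x := by
    intro g z
    rw [hQ_int, setIntegral_ball_comp_sub_right]
  have hQ_ac : Q ≪ volume :=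
    (Measure.smul_absolutelyContinuous).trans Measure.restrict_le_self.absolutelyContinuous
  have hF_meas : AEStronglyMeasurable
      (fun p : EuclideanSpace ℝ (Fin n) × EuclideanSpace ℝ (Fin n) => f (p.1 - p.2))
      (Q.prod P) :=
    (hf_loc.aestronglyMeasurable.comp_quasiMeasurePreserving
      (quasiMeasurePreserving_sub volume volume)).mono_ac
      (hQ_ac.prod (withDensity_absolutelyContinuous _ _))
  have hF : MemLp
      (fun p : EuclideanSpace ℝ (Fin n) × EuclideanSpace ℝ (Fin n) => f (p.1 - p.2)) 2
      (Q.prod P) := by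
    refine (memLp_two_iff_integrable_sq hF_meas).2 ?_
    refine (integrable_prod_iff' (hF_meas.pow 2)).2 ⟨.of_forall fun z => ?_, ?_⟩
    · refine Integrable.smul_measure ?_ (ENNReal.inv_ne_top.2 hB0)
      have hpre : (fun x => x - z) ⁻¹' ball (c - z) r = ball c r := by
        ext x; simp [mem_ball, dist_eq_norm]
      have := ((measurePreserving_sub_right volume z).integrableOn_comp_preimage
        (measurableEmbedding_subRight z)).2 (hf_loc2 (c - z) r)
      rwa [hpre] at this
    · refine Integrable.of_bound (C := (volume (ball c r)).toReal⁻¹ *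
        ∫ x in ball c (r + t), f x ^ 2) ((hF_meas.pow 2).norm.prod_swap.integral_prod_right') ?_
      filter_upwards [hP_norm] with z hz
      have hsub : ball (c - z) r ⊆ ball c (r + t) :=
        ball_subset_ball' (by simpa [dist_eq_norm] using hz)
      rw [Real.norm_of_nonneg (integral_nonneg fun _ => norm_nonneg _)]
      simp only [Real.norm_of_nonneg (sq_nonneg (f _)), Pi.pow_apply]
      rw [hQ_translate (fun x => f x ^ 2) z]
      refine mul_le_mul_of_nonneg_left ?_ (by positivity)
      exact setIntegral_mono_set (hf_loc2 c (r + t)) (.of_forall fun _ => sq_nonneg _)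
        hsub.eventuallyLE
  have hA : ∀ x, Atf x = ∫ z, f (x - z) ∂P := by
    intro x
    rw [hAtf, hP_int, ← integral_sub_left_eq_self _ volume x]
    simp only [sub_sub_cancel, hψ]
  have hM0 : 0 ≤ M := (Real.sqrt_nonneg _).trans (hM 0 (by simpa using ht.le))
  refine Real.sqrt_le_iff.2 ⟨hM0, ?_⟩
  rw [← hQ_int, ← hQ_int]
  simp only [hA]
  refine integral_sq_sub_integral_average_le hF ?_
  filter_upwards [hP_norm] with z hz
  have h := (Real.sqrt_le_iff.1 (hM z hz)).2
  rw [hvol, ← hQ_translate f z] at h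
  rwa [← hQ_translate (fun x => (f x - ∫ x, f (x - z) ∂Q) ^ 2) z] at h
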